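/- Let A be a C*-algebra that is not weakly central. (a) If for every M ∈ T_A the quotient A/M admits a tracial state, then the norm-closure of [A,A] (the linear span of all commutators ab − ba in A) is contained in CQ(A). (b) If there is some M ∈ T_A such that A/M does not admit a tracial state, then [A,A] is not contained in CQ(A). -/

import Mathlib

open Filter Topology Pointwise

namespace CQP

variable {R : Type*} [NonUnitalRing R] [TopologicalSpace R]

/-- `I` is a closed two-sided ideal of the (C*-)algebra `S` (a subset of the ambient algebra). -/
def IsIdealOf (I S : Set R) : Prop :=
  I ⊆ S ∧ IsClosed I ∧ (0 : R) ∈ I ∧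
  (∀ x ∈ I, ∀ y ∈ I, x + y ∈ I) ∧ (∀ x ∈ I, -x ∈ I) ∧
  (∀ x ∈ I, ∀ a ∈ S, a * x ∈ I ∧ x * a ∈ I)

/-- The centre of the algebra `S`. -/
def centerOf (S : Set R) : Set R := {z ∈ S | ∀ x ∈ S, z * x = x * z}

/-- `e` is a unit for `S` relative to (modulo) the ideal `M`. -/
def IsRelUnitMod (S M : Set R) (e : R) : Prop :=
  e ∈ S ∧ ∀ x ∈ S, x - x * e ∈ M ∧ x - e * x ∈ M

/-- `M` is a modular maximal ideal of the algebra `S`. -/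
def IsModMaxIdealOf (M S : Set R) : Prop :=
  IsIdealOf M S ∧ M ≠ S ∧
  (∀ I, IsIdealOf I S → M ⊆ I → I = M ∨ I = S) ∧
  ∃ e, IsRelUnitMod S M e

/-- The algebra `S` is weakly central. -/
def WeaklyCentral (S : Set R) : Prop :=
  (∀ M, IsModMaxIdealOf M S → ¬ centerOf S ⊆ M) ∧
  (∀ M N, IsModMaxIdealOf M S → IsModMaxIdealOf N S →
    M ∩ centerOf S = N ∩ centerOf S → M = N)

/-- The algebra `S` has the centre-quotient property: every central element of a quotient
of `S` lifts to a central element of `S` modulo the ideal. -/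
def HasCQ (S : Set R) : Prop :=
  ∀ I, IsIdealOf I S → ∀ a ∈ S, (∀ x ∈ S, a * x - x * a ∈ I) →
    ∃ z ∈ centerOf S, a - z ∈ I

/-- `a` is a CQ-element of the algebra `S`. -/
def IsCQElem (S : Set R) (a : R) : Prop :=
  a ∈ S ∧ ∀ I, IsIdealOf I S → (∀ x ∈ S, a * x - x * a ∈ I) →
    ∃ z ∈ centerOf S, a - z ∈ I

/-- The set of CQ-elements of `S`. -/
def CQset (S : Set R) : Set R := {a | IsCQElem S a}

/-- The set `T_A` of modular maximal ideals witnessing the failure of weak centrality. -/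
def Tset (S : Set R) : Set (Set R) :=
  {M | IsModMaxIdealOf M S ∧
    (centerOf S ⊆ M ∨ ∃ N, IsModMaxIdealOf N S ∧ N ≠ M ∧
      ¬ centerOf S ⊆ M ∧ ¬ centerOf S ⊆ N ∧ M ∩ centerOf S = N ∩ centerOf S)}

/-- The closed two-sided ideal of `S` generated by the set `X`. -/
def genIdealOf (S X : Set R) : Set R := ⋂₀ {I | IsIdealOf I S ∧ X ⊆ I}

/-- The quotient `A/J` (of the full algebra by the ideal `J`) has the centre-quotient
property, expressed via the correspondence between ideals of `A/J` and ideals of `A`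
containing `J`. -/
def HasCQmod (J : Set R) : Prop :=
  ∀ I : Set R, IsIdealOf I (Set.univ : Set R) → J ⊆ I → ∀ a : R,
    (∀ x : R, a * x - x * a ∈ I) →
      ∃ z : R, (∀ x : R, z * x - x * z ∈ J) ∧ a - z ∈ I


end CQP

open CQP

open scoped ComplexOrder

/-- The quotient `A/M` (by the closed ideal `M`) admits a tracial state: equivalently
there is a positive tracial continuous linear functional of norm one on `A`
vanishing on `M`. -/
def QuotientHasTracialState {A : Type*} [NonUnitalCStarAlgebra A] (M : Set A) : Prop :=
  ∃ τ : A →L[ℂ] ℂ, ‖τ‖ = 1 ∧ (∀ x ∈ M, τ x = 0) ∧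
    (∀ x y : A, τ (x * y) = τ (y * x)) ∧ (∀ x : A, 0 ≤ τ (star x * x))

/-- The linear span `[A,A]` of all commutators of `A`. -/
def commutatorSpan (A : Type*) [NonUnitalCStarAlgebra A] : Set A :=
  (Submodule.span ℂ {x : A | ∃ a b : A, x = a * b - b * a} : Submodule ℂ A)

universe u

namespace CQP

section Quotient

variable {B : Type*} [CStarAlgebra B]

/-- A self-adjoint element of a unital C*-algebra is almost annihilated by a self-adjoint
contraction which is the unit modulo the ideal generated by the element. -/
theorem exists_damping {j : B} (hj : IsSelfAdjoint j) {ε : ℝ} (hε : 0 < ε) :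
    ∃ w v : B, IsSelfAdjoint w ∧ ‖w‖ ≤ 1 ∧ ‖j * w‖ ≤ ε ∧ 1 - w = j * v := by
  set n : ℝ := (ε ^ 2)⁻¹ with hn
  have hn0 : 0 < n := by positivity
  have hpos : ∀ t : ℝ, 0 < 1 + n * t ^ 2 := fun t ↦ by positivity
  have hc : Continuous fun t : ℝ ↦ (1 + n * t ^ 2)⁻¹ :=
    Continuous.inv₀ (by fun_prop) fun t ↦ (hpos t).ne'
  have hid : Continuous fun t : ℝ ↦ t := continuous_id
  refine ⟨cfc (fun t : ℝ ↦ (1 + n * t ^ 2)⁻¹) j,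
    cfc (fun t : ℝ ↦ n * t * (1 + n * t ^ 2)⁻¹) j, cfc_predicate _ _, ?_, ?_, ?_⟩
  · refine norm_cfc_le zero_le_one fun t _ ↦ ?_
    rw [Real.norm_of_nonneg (inv_nonneg.2 (hpos t).le)]
    exact inv_le_one_of_one_le₀ (by nlinarith [mul_nonneg hn0.le (sq_nonneg t)])
  · have h1 : cfc (fun t : ℝ ↦ t * (1 + n * t ^ 2)⁻¹) j
        = j * cfc (fun t : ℝ ↦ (1 + n * t ^ 2)⁻¹) j := by
      rw [cfc_mul (fun t : ℝ ↦ t) _ j hid.continuousOn hc.continuousOn, cfc_id' ℝ j]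
    rw [← h1]
    refine norm_cfc_le hε.le fun t _ ↦ ?_
    rw [norm_mul, norm_inv, Real.norm_of_nonneg (hpos t).le, ← div_eq_mul_inv,
      div_le_iff₀ (hpos t), Real.norm_eq_abs]
    have h2 : ε * (1 + n * t ^ 2) = ε + t ^ 2 / ε := by
      rw [hn]; field_simp
    rw [h2, ← sq_abs t]
    have h3 : ε + |t| ^ 2 / ε - |t| = ((ε - |t|) ^ 2 + ε * |t|) / ε := by field_simp; ring
    have h4 : 0 ≤ ((ε - |t|) ^ 2 + ε * |t|) / ε := by positivity
    linarith
  · have h1 : cfc (fun t : ℝ ↦ t * (n * t * (1 + n * t ^ 2)⁻¹)) j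
        = j * cfc (fun t : ℝ ↦ n * t * (1 + n * t ^ 2)⁻¹) j := by
      rw [cfc_mul (fun t : ℝ ↦ t) (fun t : ℝ ↦ n * t * (1 + n * t ^ 2)⁻¹) j hid.continuousOn
        (((continuous_const.mul hid).mul hc).continuousOn), cfc_id' ℝ j]
    rw [← h1, ← cfc_const_one ℝ j, ← cfc_sub (fun _ : ℝ ↦ (1 : ℝ)) _ j
      continuous_const.continuousOn hc.continuousOn]
    refine cfc_congr fun t _ ↦ ?_
    have := (hpos t).ne'
    field_simp
    ring

/-- Closed two-sided ideals of C*-algebras are self-adjoint. -/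
theorem star_mem_of_isClosed_ideal (J : Ideal B) [J.IsTwoSided] (hJ : IsClosed (J : Set B))
    {x : B} (hx : x ∈ J) : star x ∈ J := by
  rw [← SetLike.mem_coe, ← hJ.closure_eq, Metric.mem_closure_iff]
  intro ε hε
  obtain ⟨w, v, hw, hw1, hjw, hv⟩ :=
    exists_damping (IsSelfAdjoint.star_mul_self x) (ε := (ε / 2) ^ 2) (by positivity)
  have hu : 1 - w ∈ J := by
    rw [hv]
    exact J.mul_mem_right _ (J.mul_mem_left _ hx)
  refine ⟨(1 - w) * star x, J.mul_mem_right _ hu, ?_⟩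
  have h1 : ‖x * w‖ ^ 2 ≤ (ε / 2) ^ 2 := by
    rw [sq, ← CStarRing.norm_star_mul_self, star_mul, hw.star_eq]
    calc ‖w * star x * (x * w)‖ = ‖w * (star x * x * w)‖ := by simp only [mul_assoc]
      _ ≤ ‖w‖ * ‖star x * x * w‖ := norm_mul_le _ _
      _ ≤ 1 * (ε / 2) ^ 2 := by gcongr
      _ = _ := one_mul _
  have h2 : ‖x * w‖ ≤ ε / 2 := abs_le_of_sq_le_sq' h1 (by positivity) |>.2
  have h3 : star x - (1 - w) * star x = star (x * w) := by
    rw [star_mul, hw.star_eq]; noncomm_ring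
  rw [dist_eq_norm, h3, norm_star]
  linarith

/-- The C*-inequality for the quotient norm. -/
theorem norm_mk_sq_le (J : Ideal B) [J.IsTwoSided] [hJ : IsClosed (J : Set B)] (x : B) :
    ‖Ideal.Quotient.mk J x‖ ^ 2 ≤ ‖Ideal.Quotient.mk J (star x * x)‖ := by
  refine le_of_forall_pos_le_add fun ε hε ↦ ?_
  obtain ⟨m, hm, hmr⟩ : ∃ m : B, Ideal.Quotient.mk J m = Ideal.Quotient.mk J (star x * x) ∧
      ‖m‖ < ‖Ideal.Quotient.mk J (star x * x)‖ + ε / 2 :=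
    QuotientAddGroup.exists_norm_mk_lt (S := J.toAddSubgroup) _ (half_pos hε)
  have hmJ : m - star x * x ∈ J := Ideal.Quotient.eq.1 hm
  set y : B := (2⁻¹ : ℝ) • (m + star m) with hy
  have hym : ‖y‖ ≤ ‖m‖ := by
    rw [hy, norm_smul]
    have := norm_add_le m (star m)
    rw [norm_star] at this
    norm_num
    linarith
  have hsx : IsSelfAdjoint (star x * x) := IsSelfAdjoint.star_mul_self x
  have hyJ : y - star x * x ∈ J := by
    have h1 : star m - star x * x ∈ J := by
      have := star_mem_of_isClosed_ideal J hJ hmJ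
      rwa [star_sub, hsx.star_eq] at this
    have h2 : y - star x * x
        = algebraMap ℝ B 2⁻¹ * ((m - star x * x) + (star m - star x * x)) := by
      rw [hy, ← Algebra.smul_def]
      module
    rw [h2]
    exact J.mul_mem_left _ (J.add_mem hmJ h1)
  have hysa : IsSelfAdjoint y := by
    rw [IsSelfAdjoint, hy, star_smul, star_add, star_star, star_trivial, add_comm]
  obtain ⟨w, v, hw, hw1, hjw, hv⟩ := exists_damping (hysa.sub hsx) (half_pos hε)
  have hu : 1 - w ∈ J := by
    rw [hv]
    exact J.mul_mem_right _ hyJ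
  have h1 : Ideal.Quotient.mk J x = Ideal.Quotient.mk J (x * w) := by
    rw [Ideal.Quotient.eq]
    have : x - x * w = x * (1 - w) := by noncomm_ring
    rw [this]
    exact J.mul_mem_left _ hu
  have h2 : ‖x * w‖ ^ 2 ≤ ‖y‖ + ε / 2 := by
    rw [sq, ← CStarRing.norm_star_mul_self, star_mul, hw.star_eq]
    calc ‖w * star x * (x * w)‖ = ‖w * y * w - w * ((y - star x * x) * w)‖ := by
          congr 1; noncomm_ring
      _ ≤ ‖w * y * w‖ + ‖w * ((y - star x * x) * w)‖ := norm_sub_le _ _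
      _ ≤ ‖w‖ * ‖y‖ * ‖w‖ + ‖w‖ * ‖(y - star x * x) * w‖ := by
          gcongr
          · exact (norm_mul_le _ _).trans (by gcongr; exact norm_mul_le _ _)
          · exact norm_mul_le _ _
      _ ≤ 1 * ‖y‖ * 1 + 1 * (ε / 2) := by gcongr
      _ = _ := by ring
  have h3 : ‖Ideal.Quotient.mk J (x * w)‖ ≤ ‖x * w‖ := QuotientAddGroup.norm_mk_le_norm
  rw [h1]
  calc ‖Ideal.Quotient.mk J (x * w)‖ ^ 2 ≤ ‖x * w‖ ^ 2 := by gcongr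
    _ ≤ _ := by linarith

/-- The quotient of a unital C*-algebra by a closed two-sided ideal is a C*-algebra. -/
theorem exists_cstar_quotient {B : Type u} [CStarAlgebra B] (J : Ideal B) [J.IsTwoSided]
    (hJ : IsClosed (J : Set B)) :
    ∃ (Q : Type u) (_ : CStarAlgebra Q) (π : B →⋆ₐ[ℂ] Q),
      Function.Surjective π ∧ ∀ x, π x = 0 ↔ x ∈ J := by
  have := hJ
  have hstar : ∀ {x}, x ∈ J → star x ∈ J := star_mem_of_isClosed_ideal J hJ
  have hlift : ∀ (x : B ⧸ J) {ε : ℝ}, 0 < ε →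
      ∃ m : B, Ideal.Quotient.mk J m = x ∧ ‖m‖ < ‖x‖ + ε := fun x ε hε ↦
    QuotientAddGroup.exists_norm_mk_lt (S := J.toAddSubgroup) x hε
  have hle : ∀ m : B, ‖Ideal.Quotient.mk J m‖ ≤ ‖m‖ := fun m ↦ QuotientAddGroup.norm_mk_le_norm
  have hmul : ∀ x y : B ⧸ J, ‖x * y‖ ≤ ‖x‖ * ‖y‖ := fun x y ↦ by
    have key : ∀ ε : ℝ, 0 < ε → ‖x * y‖ ≤ (‖x‖ + ε) * (‖y‖ + ε) := fun ε hε ↦ by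
      obtain ⟨a, rfl, ha⟩ := hlift x hε
      obtain ⟨b, rfl, hb⟩ := hlift y hε
      rw [← map_mul]
      calc _ ≤ ‖a * b‖ := hle _
        _ ≤ ‖a‖ * ‖b‖ := norm_mul_le _ _
        _ ≤ _ := by gcongr
    have hlim : Tendsto (fun ε : ℝ ↦ (‖x‖ + ε) * (‖y‖ + ε)) (𝓝[>] 0) (𝓝 (‖x‖ * ‖y‖)) := by
      have : Continuous fun ε : ℝ ↦ (‖x‖ + ε) * (‖y‖ + ε) := by fun_prop
      simpa using (this.tendsto 0).mono_left nhdsWithin_le_nhds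
    exact ge_of_tendsto hlim (eventually_mem_nhdsWithin.mono fun ε hε ↦ key ε hε)
  let iNR : NormedRing (B ⧸ J) :=
    { Ideal.Quotient.ring J, Submodule.Quotient.normedAddCommGroup J with
      norm_mul_le := hmul }
  let iAlg : Algebra ℂ (B ⧸ J) := Ideal.Quotient.algebra ℂ
  let iNA : NormedAlgebra ℂ (B ⧸ J) :=
    { iAlg with norm_smul_le := (Submodule.Quotient.normedSpace J ℂ).norm_smul_le }
  let iStar : StarRing (B ⧸ J) :=
    { star := Quotient.map' star fun x y h ↦ by
        rw [Submodule.quotientRel_def] at h ⊢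
        rw [← star_sub]
        exact hstar h
      star_involutive := by
        rintro ⟨x⟩
        exact congrArg (Ideal.Quotient.mk J) (star_star x)
      star_mul := by
        rintro ⟨x⟩ ⟨y⟩
        exact congrArg (Ideal.Quotient.mk J) (star_mul x y)
      star_add := by
        rintro ⟨x⟩ ⟨y⟩
        exact congrArg (Ideal.Quotient.mk J) (star_add x y) }
  have iSM : StarModule ℂ (B ⧸ J) := ⟨by
    rintro r ⟨x⟩
    exact congrArg (Ideal.Quotient.mk J) (star_smul r x)⟩
  have iC : CStarRing (B ⧸ J) := ⟨by
    rintro ⟨x⟩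
    have := norm_mk_sq_le J x
    rw [sq] at this
    exact this⟩
  have iCS : CompleteSpace (B ⧸ J) := Submodule.Quotient.completeSpace J
  exact ⟨B ⧸ J, { iNR, iStar, iNA, iC, iSM, iCS with },
    { Ideal.Quotient.mkₐ ℂ J with map_star' := fun _ ↦ rfl },
    Ideal.Quotient.mk_surjective, fun _ ↦ Ideal.Quotient.eq_zero_iff_mem⟩

end Quotient

section Ideals

variable {A : Type*} [NonUnitalCStarAlgebra A]

/-- If `e` is a right unit modulo an algebraic ideal `U` and lies in its closure, then `e ∈ U`. -/
theorem mem_of_mem_closure_of_relUnit {U : Set A} {e : A}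
    (hadd : ∀ x ∈ U, ∀ y ∈ U, x + y ∈ U) (hmul : ∀ x ∈ U, ∀ a, a * x ∈ U ∧ x * a ∈ U)
    (he : ∀ x, x - x * e ∈ U) (hcl : e ∈ closure U) : e ∈ U := by
  obtain ⟨u, hu, hdist⟩ := Metric.mem_closure_iff.1 hcl 1 one_pos
  rw [dist_eq_norm] at hdist
  set y : A := e - u with hy
  have hy1 : ‖(y : Unitization ℂ A)‖ < 1 := by rwa [Unitization.norm_inr]
  set v : (Unitization ℂ A)ˣ := Units.oneSub _ hy1 with hv
  have hvv : (1 - (y : Unitization ℂ A)) * (↑v⁻¹ : Unitization ℂ A) = 1 := by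
    have := v.mul_inv
    rwa [hv, Units.val_oneSub] at this
  have hve : (↑v⁻¹ : Unitization ℂ A) = 1 + y * ↑v⁻¹ := by
    rw [sub_mul, one_mul, sub_eq_iff_eq_add] at hvv
    exact hvv
  obtain ⟨s, hs⟩ : ∃ s : A, (s : Unitization ℂ A) = y * ↑v⁻¹ := by
    refine ⟨((y : Unitization ℂ A) * ↑v⁻¹).snd, Unitization.ext ?_ ?_⟩ <;> simp
  set t : A := (e - e * e) + e * u with ht
  have htU : t ∈ U := hadd _ (he e) _ (hmul u hu e).1
  have het : e = t + t * s := by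
    apply Unitization.inr_injective (R := ℂ)
    rw [Unitization.inr_add, Unitization.inr_mul, hs]
    have h1 : (e : Unitization ℂ A) * (1 - y) = t := by
      rw [ht, hy]
      simp only [Unitization.inr_add, Unitization.inr_sub, Unitization.inr_mul]
      noncomm_ring
    calc (e : Unitization ℂ A) = e * ((1 - y) * ↑v⁻¹) := by rw [hvv, mul_one]
      _ = t * ↑v⁻¹ := by rw [← mul_assoc, h1]
      _ = t * (1 + y * ↑v⁻¹) := by rw [← hve]
      _ = _ := by rw [mul_add, mul_one]
  rw [het]
  exact hadd _ htU _ (hmul _ htU _).2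

theorem IsIdealOf.smul_mem {I : Set A} (hI : IsIdealOf I Set.univ) (c : ℂ) {x : A} (hx : x ∈ I) :
    c • x ∈ I := by
  obtain ⟨-, hcl, -, -, -, hmul⟩ := hI
  rw [← hcl.closure_eq, Metric.mem_closure_iff]
  intro ε hε
  set δ : ℝ := ε / (‖c‖ + 1) with hδ
  have hc : 0 < ‖c‖ + 1 := by positivity
  have hδ0 : 0 < δ := by positivity
  obtain ⟨w, v, hw, hw1, hjw, hv⟩ :=
    exists_damping (IsSelfAdjoint.star_mul_self (x : Unitization ℂ A)) (ε := δ ^ 2) (by positivity)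
  obtain ⟨s, hs⟩ : ∃ s : A, (s : Unitization ℂ A) = (x : Unitization ℂ A) * v := by
    refine ⟨((x : Unitization ℂ A) * v).snd, Unitization.ext ?_ ?_⟩ <;> simp
  refine ⟨x * (c • (star x * s)), (hmul x hx _ trivial).2, ?_⟩
  have h1 : ‖(x : Unitization ℂ A) * w‖ ^ 2 ≤ δ ^ 2 := by
    rw [sq, ← CStarRing.norm_star_mul_self, star_mul, hw.star_eq]
    calc ‖w * star (x : Unitization ℂ A) * (x * w)‖
        = ‖w * (star (x : Unitization ℂ A) * x * w)‖ := by simp only [mul_assoc]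
      _ ≤ ‖w‖ * ‖star (x : Unitization ℂ A) * x * w‖ := norm_mul_le _ _
      _ ≤ 1 * δ ^ 2 := by gcongr
      _ = _ := one_mul _
  have h2 : ‖(x : Unitization ℂ A) * w‖ ≤ δ := abs_le_of_sq_le_sq' h1 hδ0.le |>.2
  have h3 : ((c • x - x * (c • (star x * s)) : A) : Unitization ℂ A)
      = c • ((x : Unitization ℂ A) * w) := by
    have h4 : w = 1 - star (x : Unitization ℂ A) * x * v := by rw [← hv]; abel
    rw [Unitization.inr_sub, Unitization.inr_mul, Unitization.inr_smul, Unitization.inr_smul,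
      Unitization.inr_mul, hs, Unitization.inr_star, mul_smul_comm, ← smul_sub, h4, mul_sub,
      mul_one, mul_assoc (star (x : Unitization ℂ A))]
  rw [dist_eq_norm, ← Unitization.norm_inr (𝕜 := ℂ), h3, norm_smul]
  calc ‖c‖ * ‖(x : Unitization ℂ A) * w‖ ≤ ‖c‖ * δ := by gcongr
    _ < (‖c‖ + 1) * δ := by gcongr; linarith
    _ = ε := by rw [hδ]; field_simp

/-- A closed two-sided ideal of `A`, as an ideal of the unitization. -/
def unitizationIdeal {I : Set A} (hI : IsIdealOf I Set.univ) : Ideal (Unitization ℂ A) where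
  carrier := {x | ∃ y ∈ I, (y : Unitization ℂ A) = x}
  zero_mem' := ⟨0, hI.2.2.1, Unitization.inr_zero ℂ⟩
  add_mem' := by
    rintro _ _ ⟨x, hx, rfl⟩ ⟨y, hy, rfl⟩
    exact ⟨x + y, hI.2.2.2.1 x hx y hy, Unitization.inr_add ℂ x y⟩
  smul_mem' := by
    rintro a _ ⟨x, hx, rfl⟩
    refine ⟨a.fst • x + a.snd * x,
      hI.2.2.2.1 _ (hI.smul_mem _ hx) _ (hI.2.2.2.2.2 x hx _ trivial).1, ?_⟩
    ext <;> simp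

theorem mem_unitizationIdeal {I : Set A} (hI : IsIdealOf I Set.univ) {x : Unitization ℂ A} :
    x ∈ unitizationIdeal hI ↔ ∃ y ∈ I, (y : Unitization ℂ A) = x := Iff.rfl

theorem inr_mem_unitizationIdeal {I : Set A} (hI : IsIdealOf I Set.univ) {x : A} :
    (x : Unitization ℂ A) ∈ unitizationIdeal hI ↔ x ∈ I :=
  ⟨fun ⟨_, hy, h⟩ ↦ Unitization.inr_injective h ▸ hy, fun h ↦ ⟨x, h, rfl⟩⟩

theorem isTwoSided_unitizationIdeal {I : Set A} (hI : IsIdealOf I Set.univ) :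
    (unitizationIdeal hI).IsTwoSided := ⟨by
  rintro _ b ⟨x, hx, rfl⟩
  refine ⟨b.fst • x + x * b.snd,
    hI.2.2.2.1 _ (hI.smul_mem _ hx) _ (hI.2.2.2.2.2 x hx _ trivial).2, ?_⟩
  ext <;> simp⟩

theorem isClosed_unitizationIdeal {I : Set A} (hI : IsIdealOf I Set.univ) :
    IsClosed (unitizationIdeal hI : Set (Unitization ℂ A)) :=
  (Unitization.isometry_inr (𝕜 := ℂ) (A := A)).isClosedEmbedding.isClosedMap I hI.2.1

theorem IsIdealOf.star_mem {I : Set A} (hI : IsIdealOf I Set.univ) {x : A} (hx : x ∈ I) :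
    star x ∈ I := by
  have := isTwoSided_unitizationIdeal hI
  rw [← inr_mem_unitizationIdeal hI, Unitization.inr_star]
  exact star_mem_of_isClosed_ideal _ (isClosed_unitizationIdeal hI)
    ((inr_mem_unitizationIdeal hI).2 hx)

theorem isIdealOf_closure {U : Set A} (h0 : (0 : A) ∈ U) (hadd : ∀ x ∈ U, ∀ y ∈ U, x + y ∈ U)
    (hneg : ∀ x ∈ U, -x ∈ U) (hmul : ∀ x ∈ U, ∀ a, a * x ∈ U ∧ x * a ∈ U) :
    IsIdealOf (closure U) Set.univ :=
  ⟨Set.subset_univ _, isClosed_closure, subset_closure h0,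
    fun _ hx _ hy ↦ map_mem_closure₂ continuous_add hx hy hadd,
    fun _ hx ↦ map_mem_closure continuous_neg hx hneg,
    fun _ hx a _ ↦ ⟨map_mem_closure (continuous_const_mul a) hx fun y hy ↦ (hmul y hy a).1,
      map_mem_closure (f := (· * a)) (continuous_mul_const a) hx fun y hy ↦ (hmul y hy a).2⟩⟩

theorem IsIdealOf.sub_mem {I : Set A} (hI : IsIdealOf I Set.univ) {x y : A} (hx : x ∈ I)
    (hy : y ∈ I) : x - y ∈ I := by
  rw [sub_eq_add_neg]
  exact hI.2.2.2.1 _ hx _ (hI.2.2.2.2.1 _ hy)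

theorem IsIdealOf.eq_univ_of_relUnit_mem {I J : Set A} (hI : IsIdealOf I Set.univ) (hJI : J ⊆ I)
    {e : A} (he : ∀ x, x - x * e ∈ J) (heI : e ∈ I) : I = Set.univ := by
  refine Set.eq_univ_of_forall fun x ↦ ?_
  have := hI.2.2.2.1 _ (hJI (he x)) _ (hI.2.2.2.2.2 e heI x trivial).1
  rwa [sub_add_cancel] at this

/-- Every proper modular closed ideal is contained in a modular maximal ideal. -/
theorem exists_le_isModMaxIdealOf {J : Set A} (hJ : IsIdealOf J Set.univ) {e : A}
    (he : ∀ x, x - x * e ∈ J ∧ x - e * x ∈ J) (heJ : e ∉ J) :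
    ∃ M, IsModMaxIdealOf M Set.univ ∧ J ⊆ M ∧ e ∉ M := by
  obtain ⟨M, hJM, hM⟩ := zorn_subset_nonempty
    {K : Set A | IsIdealOf K Set.univ ∧ J ⊆ K ∧ e ∉ K} (fun c hc hchain hne ↦ by
      obtain ⟨K₀, hK₀⟩ := hne
      have hadd : ∀ x ∈ ⋃₀ c, ∀ y ∈ ⋃₀ c, x + y ∈ ⋃₀ c := by
        rintro x ⟨K, hK, hx⟩ y ⟨L, hL, hy⟩
        rcases hchain.total hK hL with h | h
        · exact ⟨L, hL, (hc hL).1.2.2.2.1 _ (h hx) _ hy⟩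
        · exact ⟨K, hK, (hc hK).1.2.2.2.1 _ hx _ (h hy)⟩
      have hmul : ∀ x ∈ ⋃₀ c, ∀ a, a * x ∈ ⋃₀ c ∧ x * a ∈ ⋃₀ c := by
        rintro x ⟨K, hK, hx⟩ a
        have := (hc hK).1.2.2.2.2.2 x hx a trivial
        exact ⟨⟨K, hK, this.1⟩, ⟨K, hK, this.2⟩⟩
      refine ⟨closure (⋃₀ c), ⟨isIdealOf_closure ⟨K₀, hK₀, (hc hK₀).1.2.2.1⟩ hadd ?_ hmul,
        fun x hx ↦ subset_closure ⟨K₀, hK₀, (hc hK₀).2.1 hx⟩, fun hecl ↦ ?_⟩,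
        fun K hK x hx ↦ subset_closure ⟨K, hK, hx⟩⟩
      · rintro x ⟨K, hK, hx⟩
        exact ⟨K, hK, (hc hK).1.2.2.2.2.1 x hx⟩
      · obtain ⟨K, hK, heK⟩ := mem_of_mem_closure_of_relUnit hadd hmul
          (fun x ↦ ⟨K₀, hK₀, (hc hK₀).2.1 (he x).1⟩) hecl
        exact (hc hK).2.2 heK) J ⟨hJ, subset_rfl, heJ⟩
  obtain ⟨⟨hMI, -, heM⟩, hmax⟩ := hM
  refine ⟨M, ⟨hMI, fun h ↦ heM (h ▸ trivial), fun I hI hMI' ↦ ?_, e, trivial,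
    fun x _ ↦ ⟨hJM (he x).1, hJM (he x).2⟩⟩, hJM, heM⟩
  by_cases heI : e ∈ I
  · exact .inr (hI.eq_univ_of_relUnit_mem (hJM.trans hMI') (fun x ↦ (he x).1) heI)
  · exact .inl ((hmax ⟨hI, hJM.trans hMI', heI⟩ hMI').antisymm hMI')

/-- A closed ideal not contained in the modular maximal ideal `M` is algebraically
complementary to it. -/
theorem IsModMaxIdealOf.exists_add_eq {M N : Set A} (hM : IsModMaxIdealOf M Set.univ)
    (hN : IsIdealOf N Set.univ) (hNM : ¬ N ⊆ M) (x : A) : ∃ y ∈ N, x - y ∈ M := by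
  obtain ⟨hMI, -, hmax, e, -, he⟩ := hM
  set U : Set A := {x | ∃ y ∈ N, x - y ∈ M} with hU
  have hMU : M ⊆ U := fun x hx ↦ ⟨0, hN.2.2.1, by rwa [sub_zero]⟩
  have hNU : N ⊆ U := fun x hx ↦ ⟨x, hx, by rw [sub_self]; exact hMI.2.2.1⟩
  have hadd : ∀ x ∈ U, ∀ y ∈ U, x + y ∈ U := by
    rintro x ⟨x', hx', hx⟩ y ⟨y', hy', hy⟩
    refine ⟨x' + y', hN.2.2.2.1 _ hx' _ hy', ?_⟩
    rw [add_sub_add_comm]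
    exact hMI.2.2.2.1 _ hx _ hy
  have hmul : ∀ x ∈ U, ∀ a, a * x ∈ U ∧ x * a ∈ U := by
    rintro x ⟨x', hx', hx⟩ a
    have h1 := hN.2.2.2.2.2 x' hx' a trivial
    have h2 := hMI.2.2.2.2.2 _ hx a trivial
    rw [mul_sub, sub_mul] at h2
    exact ⟨⟨_, h1.1, h2.1⟩, ⟨_, h1.2, h2.2⟩⟩
  have hneg : ∀ x ∈ U, -x ∈ U := by
    rintro x ⟨x', hx', hx⟩
    refine ⟨-x', hN.2.2.2.2.1 _ hx', ?_⟩
    have := hMI.2.2.2.2.1 _ hx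
    rwa [neg_sub'] at this
  have hcl : closure U = Set.univ :=
    (hmax _ (isIdealOf_closure (hMU hMI.2.2.1) hadd hneg hmul)
      (hMU.trans subset_closure)).resolve_left
      fun h ↦ hNM ((hNU.trans subset_closure).trans h.subset)
  have heU : e ∈ U := mem_of_mem_closure_of_relUnit hadd hmul
    (fun x ↦ hMU (he x trivial).1) (hcl ▸ trivial)
  have := hadd _ (hMU (he x trivial).1) _ (hmul e heU x).1
  rwa [sub_add_cancel] at this

theorem IsModMaxIdealOf.eq_of_subset {M N : Set A} (hM : IsModMaxIdealOf M Set.univ)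
    (hN : IsModMaxIdealOf N Set.univ) (h : N ⊆ M) : N = M :=
  ((hN.2.2.1 M hM.1 h).resolve_right hM.2.1).symm

end Ideals

section Trace

/-- The linear span of the commutators, as a submodule. -/
def commutatorSubmodule (A : Type*) [NonUnitalCStarAlgebra A] : Submodule ℂ A :=
  Submodule.span ℂ {x : A | ∃ a b : A, x = a * b - b * a}

theorem commutator_mem {A : Type*} [NonUnitalCStarAlgebra A] (a b : A) :
    a * b - b * a ∈ commutatorSubmodule A :=
  Submodule.subset_span ⟨a, b, rfl⟩

theorem sesq_eq_of_diag_eq {B : Type*} [CStarAlgebra B] (τ : B →L[ℂ] ℂ)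
    (h : ∀ b : B, τ (star b * b) = τ (b * star b))
    (x y : B) : τ (x * y) = τ (y * x) := by
  have key : ∀ u v : B, τ (star u * v) + τ (star v * u) = τ (u * star v) + τ (v * star u) :=
    fun u v ↦ by
      have h1 := h (u + v)
      simp only [star_add, add_mul, mul_add, map_add] at h1
      linear_combination h1 - h u - h v
  have k1 := key (star x) y
  have k2 := key (star x) (Complex.I • y)
  simp only [star_smul, star_star, smul_mul_assoc, mul_smul_comm, map_smul, smul_eq_mul,
    Complex.star_def, Complex.conj_I] at k1 k2
  have hI := Complex.I_mul_I
  linear_combination (1 / 2 : ℂ) * k1 - (Complex.I / 2) * k2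
    + (1 / 2 : ℂ) * (τ (x * y) - τ (star y * star x) + τ (star x * star y) - τ (y * x)) * hI

variable {B : Type*} [CStarAlgebra B] [PartialOrder B] [StarOrderedRing B]

/-- Pop's trick: a positive map `T` that agrees with left multiplication by `h` modulo commutators
and satisfies `T 1 ≤ h - δ` forces `1` to be a sum of commutators. -/
theorem one_mem_commutatorSubmodule {T : B →L[ℂ] B} (hT : ∀ x, 0 ≤ x → 0 ≤ T x) {h : B}
    (hh : IsSelfAdjoint h) (hcomm : ∀ y, h * y - T y ∈ commutatorSubmodule B) {δ : ℝ} (hδ : 0 < δ)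
    (hle : algebraMap ℝ B δ ≤ h - T 1) : (1 : B) ∈ commutatorSubmodule B := by
  set r : ℝ := ‖h‖ + δ with hr
  have hr0 : 0 < r := by positivity
  have hhr : 0 ≤ algebraMap ℝ B r - h := by
    rw [sub_nonneg]
    exact hh.le_algebraMap_norm_self.trans (algebraMap_mono B (by linarith))
  set b : B := CFC.sqrt (algebraMap ℝ B r - h) with hb
  have hb0 : 0 ≤ b := CFC.sqrt_nonneg _
  have hbb : b * b = algebraMap ℝ B r - h := CFC.sqrt_mul_sqrt_self _ hhr
  set T' : B →L[ℂ] B := T + ContinuousLinearMap.mulLeftRight ℂ B b b with hT'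
  have hT'app : ∀ y, T' y = T y + b * y * b := fun y ↦ by
    rw [hT', add_apply, ContinuousLinearMap.mulLeftRight_apply]
  set S : B →L[ℂ] B := ((r⁻¹ : ℝ) : ℂ) • T' with hS
  have hSapp : ∀ y, S y = (r⁻¹ : ℝ) • T' y := fun y ↦ by
    rw [hS, smul_apply, Complex.coe_smul]
  have hSpos : ∀ x, 0 ≤ x → 0 ≤ S x := fun x hx ↦ by
    rw [hSapp, hT'app]
    have h1 := star_left_conjugate_nonneg hx b
    rw [(IsSelfAdjoint.of_nonneg hb0).star_eq] at h1
    exact smul_nonneg (inv_nonneg.2 hr0.le) (add_nonneg (hT x hx) h1)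
  set q : ℝ := ‖h‖ / r with hq
  have hq0 : 0 ≤ q := by positivity
  have hq1 : q < 1 := by rw [hq, div_lt_one hr0]; linarith
  have hS1 : S 1 ≤ algebraMap ℝ B q := by
    rw [hSapp, hT'app, mul_one, hbb]
    have h1 : T 1 + (algebraMap ℝ B r - h) ≤ algebraMap ℝ B ‖h‖ := by
      have h2 : algebraMap ℝ B r = algebraMap ℝ B ‖h‖ + algebraMap ℝ B δ := by rw [hr, map_add]
      rw [h2, ← sub_nonneg]
      rw [← sub_nonneg] at hle
      convert hle using 1
      abel
    have h2 : algebraMap ℝ B q = (r⁻¹ : ℝ) • algebraMap ℝ B ‖h‖ := by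
      rw [hq, div_eq_inv_mul, map_mul, Algebra.smul_def]
    rw [h2]
    exact smul_le_smul_of_nonneg_left h1 (inv_nonneg.2 hr0.le)
  have hiter : ∀ n : ℕ, 0 ≤ (S ^ n) 1 ∧ (S ^ n) 1 ≤ algebraMap ℝ B (q ^ n) := fun n ↦ by
    induction n with
    | zero => simp
    | succ n ih =>
      rw [pow_succ', mul_apply_eq_comp]
      refine ⟨hSpos _ ih.1, ?_⟩
      have h1 : S ((S ^ n) 1) ≤ S (algebraMap ℝ B (q ^ n)) := by
        rw [← sub_nonneg, ← map_sub]
        exact hSpos _ (sub_nonneg.2 ih.2)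
      have h2 : S (algebraMap ℝ B (q ^ n)) = (q ^ n) • S 1 := by
        rw [Algebra.algebraMap_eq_smul_one, ← Complex.coe_smul, map_smul, Complex.coe_smul]
      have h3 : algebraMap ℝ B (q ^ (n + 1)) = (q ^ n) • algebraMap ℝ B q := by
        rw [pow_succ, map_mul, Algebra.smul_def]
      rw [h3]
      exact h1.trans (h2 ▸ smul_le_smul_of_nonneg_left hS1 (by positivity))
  have hsum : Summable fun n : ℕ ↦ (S ^ n) (1 : B) :=
    Summable.of_norm_bounded (summable_geometric_of_lt_one hq0 hq1) fun n ↦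
      (CStarAlgebra.norm_le_iff_le_algebraMap _ (by positivity) (hiter n).1).2 (hiter n).2
  set y : B := ∑' n : ℕ, (S ^ n) (1 : B) with hy
  have hySy : y = 1 + S y := by
    conv_lhs => rw [hy, hsum.tsum_eq_zero_add]
    rw [hy, ContinuousLinearMap.map_tsum S hsum]
    simp only [pow_zero, pow_succ', mul_apply_eq_comp, one_apply_eq_self]
  have hmem : (r : ℂ) • (1 : B) ∈ commutatorSubmodule B := by
    have h1 : (r : ℂ) • (1 : B) = (h * y - T y) + (b * (b * y) - (b * y) * b) := by
      have h2 : T' y = r • S y := by rw [hSapp, smul_smul, mul_inv_cancel₀ hr0.ne', one_smul]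
      have h3 : r • (1 : B) = r • y - T' y := by
        rw [h2, ← smul_sub]
        congr 1
        rw [eq_sub_iff_add_eq]
        exact hySy.symm
      rw [Complex.coe_smul, h3, hT'app, ← mul_assoc, hbb, sub_mul, Algebra.smul_def]
      abel
    rw [h1]
    exact add_mem (hcomm y) (commutator_mem _ _)
  have := (commutatorSubmodule B).smul_mem (r : ℂ)⁻¹ hmem
  rwa [smul_smul, inv_mul_cancel₀ (by exact_mod_cast hr0.ne'), one_smul] at this

/-- A unital C*-algebra either has a nonzero positive trace or its unit is a sum of
commutators. -/
theorem exists_trace_or_one_mem :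
    (∃ τ : B →L[ℂ] ℂ, τ 1 ≠ 0 ∧ (∀ x y, τ (x * y) = τ (y * x)) ∧ ∀ x, 0 ≤ τ (star x * x)) ∨
      (1 : B) ∈ commutatorSubmodule B := by
  set P : Set B := {x | ∃ δ : ℝ, 0 < δ ∧ algebraMap ℝ B δ ≤ x + star x} with hP
  set K : Set B := {k | ∃ (T : B →L[ℂ] B) (h : B), (∀ x, 0 ≤ x → 0 ≤ T x) ∧ IsSelfAdjoint h ∧
    (∀ y, h * y - T y ∈ commutatorSubmodule B) ∧ k = h - T 1} with hK
  have hPopen : IsOpen P := by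
    rw [Metric.isOpen_iff]
    rintro x ⟨δ, hδ, hx⟩
    refine ⟨δ / 4, by positivity, fun y hy ↦ ⟨δ / 2, by positivity, ?_⟩⟩
    rw [Metric.mem_ball, dist_eq_norm] at hy
    set d : B := y - x + star (y - x) with hd
    have hdsa : IsSelfAdjoint d := IsSelfAdjoint.add_star_self _
    have hdn : ‖d‖ ≤ δ / 2 := by
      refine (norm_add_le _ _).trans ?_
      rw [norm_star]
      linarith
    have h1 : -algebraMap ℝ B (δ / 2) ≤ d :=
      (neg_le_neg (algebraMap_mono B hdn)).trans hdsa.neg_algebraMap_norm_le_self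
    have h2 : y + star y = (x + star x) + d := by rw [hd, star_sub]; abel
    have h3 : algebraMap ℝ B (δ / 2) = algebraMap ℝ B δ + -algebraMap ℝ B (δ / 2) := by
      rw [← map_neg, ← map_add]; congr 1; ring
    rw [h2, h3]
    exact add_le_add hx h1
  have hPconv : Convex ℝ P := by
    rintro x ⟨δ, hδ, hx⟩ y ⟨δ', hδ', hy⟩ a b ha hb hab
    refine ⟨a * δ + b * δ', ?_, ?_⟩
    · rcases ha.eq_or_lt with rfl | ha
      · rw [zero_add] at hab
        subst hab
        simpa using hδ'
      · exact add_pos_of_pos_of_nonneg (by positivity) (by positivity)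
    · have h1 := add_le_add (smul_le_smul_of_nonneg_left hx ha) (smul_le_smul_of_nonneg_left hy hb)
      rw [map_add, map_mul, map_mul, ← Algebra.smul_def, ← Algebra.smul_def]
      convert h1 using 1
      simp only [star_add, star_smul, star_trivial, smul_add]
      abel
  have hKsmul : ∀ k ∈ K, ∀ a : ℝ, 0 ≤ a → a • k ∈ K := by
    rintro k ⟨T, h, hT, hh, hc, rfl⟩ a ha
    have happ : ∀ x, ((a : ℂ) • T) x = a • T x := fun x ↦ by
      rw [smul_apply, Complex.coe_smul]
    refine ⟨(a : ℂ) • T, a • h, fun x hx ↦ ?_, (IsSelfAdjoint.all a).smul hh, fun y ↦ ?_, ?_⟩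
    · rw [happ]
      exact smul_nonneg ha (hT x hx)
    · rw [happ, smul_mul_assoc, ← smul_sub, ← Complex.coe_smul]
      exact Submodule.smul_mem _ _ (hc y)
    · rw [happ, smul_sub]
  have hKadd : ∀ k ∈ K, ∀ l ∈ K, k + l ∈ K := by
    rintro k ⟨T, h, hT, hh, hc, rfl⟩ l ⟨T', h', hT', hh', hc', rfl⟩
    refine ⟨T + T', h + h', fun x hx ↦ ?_, hh.add hh', fun y ↦ ?_, ?_⟩
    · exact add_nonneg (hT x hx) (hT' x hx)
    · rw [add_apply, add_mul, add_sub_add_comm]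
      exact add_mem (hc y) (hc' y)
    · rw [add_apply]
      abel
  have hKconv : Convex ℝ K := fun x hx y hy a b ha hb _ ↦
    hKadd _ (hKsmul x hx a ha) _ (hKsmul y hy b hb)
  have hKgen : ∀ b : B, star b * b - b * star b ∈ K := fun b ↦
    ⟨ContinuousLinearMap.mulLeftRight ℂ B b (star b), star b * b,
      fun x hx ↦ by
        rw [ContinuousLinearMap.mulLeftRight_apply]
        exact star_right_conjugate_nonneg hx b,
      IsSelfAdjoint.star_mul_self b,
      fun y ↦ by
        rw [ContinuousLinearMap.mulLeftRight_apply, mul_assoc]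
        exact commutator_mem _ _,
      by rw [ContinuousLinearMap.mulLeftRight_apply, mul_one]⟩
  by_cases hdisj : Disjoint P K
  · left
    obtain ⟨f, u, hfP, hfK⟩ := RCLike.geometric_hahn_banach_open (𝕜 := ℂ) hPconv hPopen hKconv hdisj
    simp only [RCLike.re_to_complex] at hfP hfK
    have hK0 : (0 : B) ∈ K := by simpa using hKgen 0
    have hu : u ≤ 0 := by simpa using hfK 0 hK0
    have hfre : ∀ (t : ℝ) (x : B), (f (t • x)).re = t * (f x).re := fun t x ↦ by
      rw [← Complex.coe_smul, map_smul, smul_eq_mul, Complex.re_ofReal_mul]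
    have hlin : ∀ (c d s : ℝ), (∀ t : ℝ, 0 ≤ t → c ≤ d + t * s) → 0 ≤ s := fun c d s H ↦ by
      by_contra! hs
      have h1 := H (|c - d - 1| / (-s)) (by have : 0 < -s := by linarith
                                            positivity)
      have h2 : |c - d - 1| / (-s) * s = -|c - d - 1| := by
        have := hs.ne
        field_simp
      rw [h2] at h1
      have := neg_abs_le (c - d - 1)
      have := le_abs_self (c - d - 1)
      have := H 0 le_rfl
      rcases abs_cases (c - d - 1) with ⟨h, _⟩ | ⟨h, _⟩ <;> rw [h] at h1 <;> linarith
    have hKre : ∀ k ∈ K, 0 ≤ (f k).re := fun k hk ↦ hlin u 0 _ fun t ht ↦ by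
      have := hfK _ (hKsmul k hk t ht)
      rw [hfre] at this
      linarith
    have hsa : ∀ x : B, IsSelfAdjoint x → (f x).im = 0 := fun x hx ↦ by
      have hmem : ∀ t : ℝ, t • (Complex.I • x) + 1 ∈ P := fun t ↦ by
        refine ⟨2, two_pos, le_of_eq ?_⟩
        rw [star_add, star_smul, star_smul, hx.star_eq, star_one, Complex.star_def, Complex.conj_I,
          star_trivial, neg_smul, smul_neg, map_ofNat, ← one_add_one_eq_two]
        abel
      have hval : ∀ t : ℝ, -(t * (f x).im) + (f 1).re < u := fun t ↦ by
        have := hfP _ (hmem t)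
        rw [map_add, Complex.add_re, hfre, map_smul, smul_eq_mul, Complex.I_mul_re] at this
        linarith
      refine le_antisymm ?_ (hlin (-u) (-(f 1).re) _ fun t _ ↦ by linarith [hval t])
      have := hlin (-u) (-(f 1).re) (-(f x).im) fun t _ ↦ by linarith [hval (-t)]
      linarith
    have hf1 : (f 1).re < 0 := by
      refine (hfP 1 ⟨1, one_pos, ?_⟩).trans_le hu
      rw [star_one, map_one]
      exact le_add_of_nonneg_left zero_le_one
    refine ⟨-f, ?_, sesq_eq_of_diag_eq _ fun b ↦ ?_, fun x ↦ ?_⟩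
    · rw [neg_apply, neg_ne_zero]
      intro h0
      rw [h0] at hf1
      simp at hf1
    · rw [neg_apply, neg_apply, neg_inj, ← sub_eq_zero, ← map_sub]
      refine Complex.ext ?_
        (hsa _ ((IsSelfAdjoint.star_mul_self b).sub (IsSelfAdjoint.mul_star_self b)))
      have h1 := hKre _ (hKgen b)
      have h2 := hKre _ (hKgen (star b))
      rw [star_star, ← neg_sub, map_neg, Complex.neg_re] at h2
      rw [Complex.zero_re]
      exact le_antisymm (by linarith) h1
    · rw [neg_apply, Complex.nonneg_iff, Complex.neg_re, Complex.neg_im,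
        hsa _ (IsSelfAdjoint.star_mul_self x), neg_zero]
      refine ⟨?_, rfl⟩
      refine hlin 0 (-(f 1).re) _ fun t ht ↦ ?_
      have hmem : t • (star x * x) + 1 ∈ P := by
        refine ⟨1, one_pos, ?_⟩
        have h0 : 0 ≤ t • (star x * x) := smul_nonneg ht (star_mul_self_nonneg x)
        rw [star_add, (IsSelfAdjoint.of_nonneg h0).star_eq, star_one, map_one]
        exact (le_add_of_nonneg_left h0).trans
          (le_add_of_nonneg_right (add_nonneg h0 zero_le_one))
      have := hfP _ hmem
      rw [map_add, Complex.add_re, hfre] at this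
      linarith
  · right
    obtain ⟨_, ⟨δ, hδ, hle⟩, T, h, hT, hh, hc, rfl⟩ := Set.not_disjoint_iff.1 hdisj
    refine one_mem_commutatorSubmodule hT hh hc (half_pos hδ) ?_
    have hsa : IsSelfAdjoint (h - T 1) := hh.sub (IsSelfAdjoint.of_nonneg (hT 1 zero_le_one))
    rw [hsa.star_eq, ← two_smul ℝ] at hle
    have := smul_le_smul_of_nonneg_left hle (by norm_num : (0 : ℝ) ≤ 2⁻¹)
    rw [smul_smul, inv_mul_cancel₀ two_ne_zero, one_smul] at this
    rwa [div_eq_inv_mul, map_mul, ← Algebra.smul_def]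

end Trace

section UnitalQuotient

variable {A : Type u} [NonUnitalCStarAlgebra A]

/-- The quotient by a modular closed ideal is a unital C*-algebra. -/
theorem exists_unital_quotient {M : Set A} (hM : IsIdealOf M Set.univ) {e : A}
    (he : ∀ x, x - x * e ∈ M ∧ x - e * x ∈ M) :
    ∃ (Q : Type u) (_ : CStarAlgebra Q) (q : A →⋆ₙₐ[ℂ] Q), Function.Surjective q ∧
      (∀ x, q x = 0 ↔ x ∈ M) ∧ q e = 1 := by
  have hmulA : ∀ b : Unitization ℂ A, ∃ s : A, (s : Unitization ℂ A) = b * e := fun b ↦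
    ⟨(b * e).snd, Unitization.ext (by simp) (by simp)⟩
  have h2 := isTwoSided_unitizationIdeal hM
  set J : Ideal (Unitization ℂ A) :=
    Submodule.comap (LinearMap.toSpanSingleton _ _ (e : Unitization ℂ A))
      (unitizationIdeal hM) with hJ
  have hmem : ∀ x, x ∈ J ↔ x * e ∈ unitizationIdeal hM := fun x ↦ by
    rw [hJ, Submodule.mem_comap, LinearMap.toSpanSingleton_apply, smul_eq_mul]
  have hJ2 : J.IsTwoSided := ⟨fun {x} b hx ↦ by
    rw [hmem] at hx ⊢
    obtain ⟨s, hs⟩ := hmulA b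
    have h3 : (s : Unitization ℂ A) - e * s ∈ unitizationIdeal hM := by
      rw [← Unitization.inr_mul, ← Unitization.inr_sub, inr_mem_unitizationIdeal]
      exact (he s).2
    have h4 : x * b * e = x * e * s + x * (s - e * s) := by rw [mul_assoc, ← hs]; noncomm_ring
    rw [h4]
    exact add_mem (Ideal.mul_mem_right _ _ hx) (Ideal.mul_mem_left _ _ h3)⟩
  have hJcl : IsClosed (J : Set (Unitization ℂ A)) := by
    have h3 : (J : Set (Unitization ℂ A)) =
        (· * (e : Unitization ℂ A)) ⁻¹' (unitizationIdeal hM : Set (Unitization ℂ A)) :=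
      Set.ext hmem
    rw [h3]
    exact (isClosed_unitizationIdeal hM).preimage (continuous_mul_const _)
  obtain ⟨Q, _, π, hsurj, hker⟩ := exists_cstar_quotient J hJcl
  have heq : ∀ x, π (x * e) = π x := fun x ↦ by
    rw [← sub_eq_zero, ← map_sub, hker, hmem]
    obtain ⟨s, hs⟩ := hmulA x
    rw [sub_mul, ← hs, ← neg_sub, ← Unitization.inr_mul, ← Unitization.inr_sub]
    exact neg_mem ((inr_mem_unitizationIdeal hM).2 (he s).1)
  refine ⟨Q, inferInstance, (π : Unitization ℂ A →⋆ₙₐ[ℂ] Q).comp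
    (Unitization.inrNonUnitalStarAlgHom ℂ A), fun b ↦ ?_, fun x ↦ ?_, ?_⟩
  · obtain ⟨x, rfl⟩ := hsurj b
    obtain ⟨s, hs⟩ := hmulA x
    exact ⟨s, (congrArg π hs).trans (heq x)⟩
  · change π (x : Unitization ℂ A) = 0 ↔ _
    rw [hker, hmem, ← Unitization.inr_mul, inr_mem_unitizationIdeal]
    refine ⟨fun h ↦ ?_, fun h ↦ (hM.2.2.2.2.2 x h e trivial).2⟩
    have := hM.2.2.2.1 _ (he x).1 _ h
    rwa [sub_add_cancel] at this
  · change π (e : Unitization ℂ A) = 1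
    rw [← one_mul (e : Unitization ℂ A), heq, map_one]

/-- If the quotient by `M` has no tracial state, then a unit modulo `M` is a sum of commutators
modulo `M`; these may be taken in any closed ideal complementary to `M`. -/
theorem exists_commutator_sub_mem {M L : Set A} (hM : IsIdealOf M Set.univ)
    (hL : IsIdealOf L Set.univ) (hLM : ∀ x, ∃ y ∈ L, x - y ∈ M) {e : A}
    (he : ∀ x, x - x * e ∈ M ∧ x - e * x ∈ M) (htr : ¬ QuotientHasTracialState M) :
    ∃ s ∈ commutatorSpan A, s ∈ L ∧ e - s ∈ M := by
  obtain ⟨Q, _, q, hsurj, hker, hqe⟩ := exists_unital_quotient hM he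
  let _ : PartialOrder Q := CStarAlgebra.spectralOrder Q
  have _ : StarOrderedRing Q := CStarAlgebra.spectralOrderedRing Q
  have h1 : (1 : Q) ∈ commutatorSubmodule Q := by
    refine (exists_trace_or_one_mem (B := Q)).resolve_left ?_
    rintro ⟨τ, hτ1, hτ, hpos⟩
    set σ : A →L[ℂ] ℂ := τ.comp ((q : A →ₗ[ℂ] Q).mkContinuous 1 fun x ↦ by
      simpa using NonUnitalStarAlgHom.norm_apply_le q x) with hσ
    have hσq : ∀ x, σ x = τ (q x) := fun x ↦ rfl
    have hσ0 : ‖σ‖ ≠ 0 := fun h ↦ hτ1 (by rw [← hqe, ← hσq, norm_eq_zero.1 h, zero_apply])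
    refine htr ⟨((‖σ‖⁻¹ : ℝ) : ℂ) • σ, ?_, fun x hx ↦ ?_, fun x y ↦ ?_, fun x ↦ ?_⟩
    · rw [norm_smul, Complex.norm_real, norm_inv, norm_norm, inv_mul_cancel₀ hσ0]
    · rw [smul_apply, hσq, (hker x).2 hx, map_zero, smul_zero]
    · rw [smul_apply, smul_apply, hσq, hσq, map_mul q, map_mul q, hτ]
    · rw [smul_apply, smul_eq_mul, hσq, map_mul, map_star]
      exact mul_nonneg (Complex.zero_le_real.2 (inv_nonneg.2 (norm_nonneg _))) (hpos _)
  have hlift : ∀ s ∈ commutatorSubmodule Q, ∃ s' ∈ commutatorSubmodule A, s' ∈ L ∧ q s' = s := by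
    intro s hs
    induction hs using Submodule.span_induction with
    | mem x hx =>
      obtain ⟨a, b, rfl⟩ := hx
      obtain ⟨a, rfl⟩ := hsurj a
      obtain ⟨b, rfl⟩ := hsurj b
      obtain ⟨c, hc, hac⟩ := hLM a
      have hqc : q c = q a := by
        rw [← hker, map_sub, sub_eq_zero] at hac
        exact hac.symm
      have h2 := hL.2.2.2.2.2 c hc b trivial
      exact ⟨c * b - b * c, commutator_mem _ _, hL.sub_mem h2.2 h2.1, by
        rw [map_sub, map_mul, map_mul, hqc]⟩
    | zero => exact ⟨0, zero_mem _, hL.2.2.1, map_zero q⟩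
    | add x y _ _ hx hy =>
      obtain ⟨x, hx, hxL, rfl⟩ := hx
      obtain ⟨y, hy, hyL, rfl⟩ := hy
      exact ⟨x + y, add_mem hx hy, hL.2.2.2.1 _ hxL _ hyL, map_add q _ _⟩
    | smul c x _ hx =>
      obtain ⟨x, hx, hxL, rfl⟩ := hx
      exact ⟨c • x, Submodule.smul_mem _ _ hx, hL.smul_mem c hxL, map_smul q _ _⟩
  obtain ⟨s, hs, hsL, hqs⟩ := hlift 1 h1
  exact ⟨s, hs, hsL, by rw [← hker, map_sub, hqe, hqs, sub_self]⟩

theorem not_commutatorSpan_subset_CQset {M : Set A} (hM : M ∈ Tset (Set.univ : Set A))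
    (htr : ¬ QuotientHasTracialState M) :
    ¬ commutatorSpan A ⊆ CQset (Set.univ : Set A) := by
  intro hsub
  obtain ⟨hMM, hM⟩ := hM
  obtain ⟨hMI, hMne, -, e, -, he⟩ := id hMM
  replace he : ∀ x, x - x * e ∈ M ∧ x - e * x ∈ M := fun x ↦ he x trivial
  have heM : e ∉ M := fun h ↦ hMne (hMI.eq_univ_of_relUnit_mem subset_rfl (fun x ↦ (he x).1) h)
  obtain ⟨L, hL, hLM, hLZ⟩ : ∃ L, IsIdealOf L Set.univ ∧ (∀ x, ∃ y ∈ L, x - y ∈ M) ∧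
      ∀ z ∈ centerOf (Set.univ : Set A), z ∈ L → z ∈ M := by
    rcases hM with hZ | ⟨N, hN, hNM, -, -, hZ⟩
    · refine ⟨Set.univ, ⟨subset_rfl, isClosed_univ, trivial, fun _ _ _ _ ↦ trivial,
        fun _ _ ↦ trivial, fun _ _ _ _ ↦ ⟨trivial, trivial⟩⟩,
        fun x ↦ ⟨x, trivial, by rw [sub_self]; exact hMI.2.2.1⟩, fun z hz _ ↦ hZ hz⟩
    · exact ⟨N, hN.1, hMM.exists_add_eq hN.1 fun h ↦ hNM (hMM.eq_of_subset hN h),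
        fun z hz hzN ↦ (hZ.symm.subset ⟨hzN, hz⟩).1⟩
  obtain ⟨s, hs, hsL, hes⟩ := exists_commutator_sub_mem hMI hL hLM he htr
  have hI : IsIdealOf (M ∩ L) Set.univ :=
    ⟨Set.subset_univ _, hMI.2.1.inter hL.2.1, ⟨hMI.2.2.1, hL.2.2.1⟩,
      fun x hx y hy ↦ ⟨hMI.2.2.2.1 x hx.1 y hy.1, hL.2.2.2.1 x hx.2 y hy.2⟩,
      fun x hx ↦ ⟨hMI.2.2.2.2.1 x hx.1, hL.2.2.2.2.1 x hx.2⟩,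
      fun x hx a ha ↦ ⟨⟨(hMI.2.2.2.2.2 x hx.1 a ha).1, (hL.2.2.2.2.2 x hx.2 a ha).1⟩,
        ⟨(hMI.2.2.2.2.2 x hx.1 a ha).2, (hL.2.2.2.2.2 x hx.2 a ha).2⟩⟩⟩
  obtain ⟨z, hz, hsz⟩ := (hsub hs).2 _ hI fun x _ ↦ by
    have h1 := hMI.2.2.2.2.2 _ hes x trivial
    have h2 := hL.2.2.2.2.2 _ hsL x trivial
    refine ⟨?_, hL.sub_mem h2.2 h2.1⟩
    have h3 : s * x - x * s = (x * (e - s) - (e - s) * x) + ((x - x * e) - (x - e * x)) := by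
      noncomm_ring
    rw [h3]
    exact hMI.2.2.2.1 _ (hMI.sub_mem h1.1 h1.2) _ (hMI.sub_mem (he x).1 (he x).2)
  have hzL : z ∈ L := by
    have := hL.sub_mem hsL hsz.2
    rwa [sub_sub_cancel] at this
  refine heM ?_
  have h4 := hMI.2.2.2.1 _ hes _ (hMI.2.2.2.1 _ hsz.1 _ (hLZ z hz hzL))
  rwa [sub_add_cancel, sub_add_cancel] at h4

end UnitalQuotient

section Center

/-- The centre of a unital C*-algebra, as a star subalgebra. -/
def starCenter (B : Type*) [CStarAlgebra B] : StarSubalgebra ℂ B :=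
  StarSubalgebra.centralizer ℂ Set.univ

theorem mem_starCenter {B : Type*} [CStarAlgebra B] {z : B} :
    z ∈ starCenter B ↔ ∀ g, g * z = z * g :=
  (StarSubalgebra.mem_centralizer_iff ℂ).trans
    ⟨fun h g ↦ (h g trivial).1, fun h g _ ↦ ⟨h g, h (star g)⟩⟩

noncomputable instance (B : Type*) [CStarAlgebra B] : CommCStarAlgebra (starCenter B) :=
  { StarSubalgebra.cstarAlgebra (starCenter B) (h_closed := by
      have : (starCenter B : Set B) = ⋂ g, {z | g * z = z * g} := by
        ext z
        simp [mem_starCenter]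
      rw [this]
      exact isClosed_iInter fun g ↦
        isClosed_eq (continuous_const_mul g) (continuous_mul_const g)) with
    mul_comm := fun x y ↦ Subtype.ext (mem_starCenter.1 y.2 x) }

open WeakDual in
/-- An element on which characters factor through the range of a *-homomorphism between
commutative unital C*-algebras lies in this range. -/
theorem exists_map_eq_of_characters {Z C : Type*} [CommCStarAlgebra Z] [CommCStarAlgebra C]
    (φ : Z →⋆ₐ[ℂ] C) (c : C)
    (h : ∀ χ₁ χ₂ : characterSpace ℂ C, (∀ z, χ₁ (φ z) = χ₂ (φ z)) → χ₁ c = χ₂ c) :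
    ∃ z, φ z = c := by
  set r : C(characterSpace ℂ C, characterSpace ℂ Z) := CharacterSpace.compContinuousMap φ with hr
  have hr_app : ∀ χ z, r χ z = χ (φ z) := fun χ z ↦ rfl
  have hcl : IsClosed (Set.range r) := (isCompact_range r.continuous).isClosed
  have hquot : IsQuotientMap (Set.rangeFactorization r) :=
    (r.continuous.rangeFactorization.isClosedMap).isQuotientMap
      r.continuous.rangeFactorization Set.rangeFactorization_surjective
  set r' : C(characterSpace ℂ C, Set.range r) := ⟨_, r.continuous.rangeFactorization⟩ with hr'
  have hfac : Function.FactorsThrough (gelfandStarTransform C c) r' := fun χ₁ χ₂ hχ ↦ by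
    have h1 : r χ₁ = r χ₂ := congrArg Subtype.val hχ
    exact h χ₁ χ₂ fun z ↦ by rw [← hr_app, h1, hr_app]
  obtain ⟨f, hf⟩ : ∃ f : C(Set.range r, ℂ), ∀ χ, f (r' χ) = χ c :=
    ⟨IsQuotientMap.lift (f := r') hquot _ hfac,
      DFunLike.congr_fun (IsQuotientMap.lift_comp (f := r') hquot _ hfac)⟩
  obtain ⟨g, hg⟩ := f.exists_restrict_eq hcl
  obtain ⟨z, rfl⟩ := (gelfandStarTransform Z).surjective g
  refine ⟨z, (gelfandStarTransform C).injective (ContinuousMap.ext fun χ ↦ ?_)⟩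
  exact (DFunLike.congr_fun hg (r' χ)).trans (hf χ)

end Center

section Characters

open WeakDual

theorem norm_character_le {C : Type*} [CommCStarAlgebra C] (χ : characterSpace ℂ C) (x : C) :
    ‖χ x‖ ≤ ‖x‖ := by
  have : Nontrivial C := ⟨1, 0, fun h ↦ by simpa using congrArg χ h⟩
  exact AlgHom.norm_apply_le_self (CharacterSpace.toAlgHom χ) x

theorem exists_character_damping {C : Type*} [CommCStarAlgebra C] (χ : characterSpace ℂ C) {d : C}
    (hd : χ d = 0) {ε : ℝ} (hε : 0 < ε) : ∃ f, ‖f‖ ≤ 1 ∧ χ f = 1 ∧ ‖f * d‖ ≤ ε := by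
  obtain ⟨w, v, hw, hw1, hjw, hv⟩ :=
    exists_damping (IsSelfAdjoint.star_mul_self d) (ε := ε ^ 2) (by positivity)
  refine ⟨w, hw1, ?_, ?_⟩
  · have h1 := congrArg χ hv
    rw [map_sub, map_one, map_mul, map_mul, hd, mul_zero, zero_mul, sub_eq_zero] at h1
    exact h1.symm
  · refine (abs_le_of_sq_le_sq' ?_ hε.le).2
    rw [sq, ← CStarRing.norm_star_mul_self, star_mul, hw.star_eq]
    calc ‖star d * w * (w * d)‖ = ‖w * (star d * d * w)‖ := by congr 1; ring
      _ ≤ ‖w‖ * ‖star d * d * w‖ := norm_mul_le _ _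
      _ ≤ 1 * ε ^ 2 := by gcongr
      _ = _ := one_mul _

variable {A : Type*} [NonUnitalCStarAlgebra A]

/-- A character of the centre of a quotient that is nonzero on the image of the algebra is
given by a modular maximal ideal. -/
theorem exists_isModMaxIdealOf_of_character {Q : Type*} [CStarAlgebra Q] (q : A →⋆ₙₐ[ℂ] Q)
    (χ : characterSpace ℂ (starCenter Q)) {e : A} {c : starCenter Q} (hc : q e = c)
    (hχ : χ c = 1) :
    ∃ M, IsModMaxIdealOf M Set.univ ∧ (∀ x, x - x * e ∈ M ∧ x - e * x ∈ M) ∧ e ∉ M ∧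
      ∀ b (d : starCenter Q), q b = d → b - χ d • e ∈ M := by
  set J : Set A := {x | ∀ ε : ℝ, 0 < ε →
    ∃ f : starCenter Q, ‖f‖ ≤ 1 ∧ χ f = 1 ∧ ‖(f : Q) * q x‖ < ε} with hJ
  have hcomm : ∀ (f : starCenter Q) (x : Q), x * f = f * x := fun f ↦ mem_starCenter.1 f.2
  have hmem : ∀ (d : starCenter Q), χ d = 0 → ∀ x y, q x = d * q y → x ∈ J := by
    intro d hd x y hxy ε hε
    have h0 : 0 < ‖q y‖ + 1 := by positivity
    obtain ⟨f, hf1, hf, hfd⟩ := exists_character_damping χ hd (div_pos hε h0)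
    refine ⟨f, hf1, hf, ?_⟩
    rw [hxy, ← mul_assoc]
    calc ‖(f : Q) * d * q y‖ ≤ ‖(f : Q) * d‖ * ‖q y‖ := norm_mul_le _ _
      _ ≤ ε / (‖q y‖ + 1) * ‖q y‖ := by gcongr; exact hfd
      _ < ε / (‖q y‖ + 1) * (‖q y‖ + 1) := by gcongr; linarith
      _ = ε := by field_simp
  have hJI : IsIdealOf J Set.univ := by
    refine ⟨Set.subset_univ _, ?_, fun ε hε ↦ ⟨1, ?_, map_one χ, by simpa using hε⟩,
      fun x hx y hy ε hε ↦ ?_, fun x hx ε hε ↦ ?_, fun x hx a _ ↦ ⟨fun ε hε ↦ ?_, fun ε hε ↦ ?_⟩⟩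
    · refine isClosed_of_closure_subset fun x hx ε hε ↦ ?_
      obtain ⟨y, hy, hxy⟩ := Metric.mem_closure_iff.1 hx (ε / 2) (half_pos hε)
      rw [dist_eq_norm] at hxy
      obtain ⟨f, hf1, hf, hfy⟩ := hy (ε / 2) (half_pos hε)
      refine ⟨f, hf1, hf, ?_⟩
      have h1 : (f : Q) * q x = f * q (x - y) + f * q y := by rw [map_sub]; noncomm_ring
      have h2 : ‖(f : Q) * q (x - y)‖ < ε / 2 := by
        refine lt_of_le_of_lt ?_ hxy
        calc ‖(f : Q) * q (x - y)‖ ≤ ‖(f : Q)‖ * ‖q (x - y)‖ := norm_mul_le _ _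
          _ ≤ 1 * ‖x - y‖ := by
            gcongr
            exacts [hf1, NonUnitalStarAlgHom.norm_apply_le q _]
          _ = _ := one_mul _
      rw [h1]
      linarith [norm_add_le ((f : Q) * q (x - y)) (f * q y)]
    · have h1 : ‖(1 : starCenter Q)‖ * ‖(1 : starCenter Q)‖ = ‖(1 : starCenter Q)‖ := by
        rw [← CStarRing.norm_star_mul_self, star_one, one_mul]
      nlinarith
    · obtain ⟨f, hf1, hf, hfx⟩ := hx (ε / 2) (half_pos hε)
      obtain ⟨g, hg1, hg, hgy⟩ := hy (ε / 2) (half_pos hε)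
      refine ⟨f * g, (norm_mul_le _ _).trans (mul_le_one₀ hf1 (norm_nonneg _) hg1),
        by rw [map_mul, hf, hg, one_mul], ?_⟩
      have h1 : ((f * g : starCenter Q) : Q) * q (x + y) = g * (f * q x) + f * (g * q y) := by
        rw [MulMemClass.coe_mul, map_add, mul_add, mul_assoc, mul_assoc, ← mul_assoc, hcomm g,
          mul_assoc]
      have h2 : ‖(g : Q) * (f * q x)‖ ≤ 1 * ‖(f : Q) * q x‖ :=
        (norm_mul_le _ _).trans (by gcongr; exact hg1)
      have h3 : ‖(f : Q) * (g * q y)‖ ≤ 1 * ‖(g : Q) * q y‖ :=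
        (norm_mul_le _ _).trans (by gcongr; exact hf1)
      rw [h1]
      linarith [norm_add_le ((g : Q) * (f * q x)) (f * (g * q y))]
    · obtain ⟨f, hf1, hf, hfx⟩ := hx ε hε
      exact ⟨f, hf1, hf, by rwa [map_neg, mul_neg, norm_neg]⟩
    all_goals
      have h0 : 0 < ‖q a‖ + 1 := by positivity
      obtain ⟨f, hf1, hf, hfx⟩ := hx _ (div_pos hε h0)
      refine ⟨f, hf1, hf, ?_⟩
      have h2 : ‖(f : Q) * q x‖ * ‖q a‖ < ε := by
        calc _ ≤ ε / (‖q a‖ + 1) * ‖q a‖ := by gcongr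
          _ < ε / (‖q a‖ + 1) * (‖q a‖ + 1) := by gcongr; linarith
          _ = ε := by field_simp
    · rw [map_mul, ← mul_assoc, ← hcomm, mul_assoc]
      exact (norm_mul_le _ _).trans_lt (by rwa [mul_comm])
    · rw [map_mul, ← mul_assoc]
      exact (norm_mul_le _ _).trans_lt h2
  have h1c : χ (1 - c) = 0 := by rw [map_sub, map_one, hχ, sub_self]
  have heJ : e ∉ J := fun h ↦ by
    obtain ⟨f, -, hf, hfe⟩ := h 1 one_pos
    have h1 := norm_character_le χ (f * c)
    rw [map_mul, hf, hχ, one_mul, norm_one] at h1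
    rw [hc] at hfe
    exact absurd hfe (not_lt.2 h1)
  have he : ∀ x, x - x * e ∈ J ∧ x - e * x ∈ J := fun x ↦ by
    refine ⟨hmem _ h1c _ x ?_, hmem _ h1c _ x ?_⟩
    · rw [map_sub, map_mul, hc, hcomm, AddSubgroupClass.coe_sub, OneMemClass.coe_one, sub_mul,
        one_mul]
    · rw [map_sub, map_mul, hc, AddSubgroupClass.coe_sub, OneMemClass.coe_one, sub_mul, one_mul]
  obtain ⟨M, hM, hJM, heM⟩ := exists_le_isModMaxIdealOf hJI he heJ
  refine ⟨M, hM, fun x ↦ ⟨hJM (he x).1, hJM (he x).2⟩, heM, fun b d hbd ↦ ?_⟩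
  have h2 : b - b * e ∈ M := hJM (he b).1
  have h3 : b * e - χ d • e ∈ M := by
    refine hJM (hmem (d - χ d • 1) ?_ _ e ?_)
    · rw [map_sub, map_smul, map_one, smul_eq_mul, mul_one, sub_self]
    · rw [map_sub, map_mul, map_smul, hbd, AddSubgroupClass.coe_sub, sub_mul]
      simp
  have := hM.1.2.2.2.1 _ h2 _ h3
  rwa [sub_add_sub_cancel] at this

end Characters

section TraceVanishing

variable {A : Type*} [NonUnitalCStarAlgebra A]

/-- If `A/M` has a tracial state, then the unit of `A/M` is not proportional to a limit of sums of
commutators. -/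
theorem eq_zero_of_sub_smul_mem {M : Set A} (hM : IsIdealOf M Set.univ)
    (htr : QuotientHasTracialState M) {e : A} (he : ∀ x, x - x * e ∈ M ∧ x - e * x ∈ M) {a : A}
    (ha : a ∈ closure (commutatorSpan A)) {l : ℂ} (hl : a - l • e ∈ M) : l = 0 := by
  obtain ⟨τ, hτn, hτM, hτ, hpos⟩ := htr
  have hτc : ∀ s ∈ commutatorSpan A, τ s = 0 := by
    intro s hs
    have hle : commutatorSubmodule A ≤ LinearMap.ker (τ : A →ₗ[ℂ] ℂ) := by
      refine Submodule.span_le.2 ?_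
      rintro _ ⟨x, y, rfl⟩
      exact (map_sub τ _ _).trans (sub_eq_zero.2 (hτ x y))
    exact hle hs
  have hτa : τ a = 0 :=
    closure_minimal (fun s hs ↦ hτc s hs) (isClosed_eq τ.continuous continuous_const) ha
  have h1 := hτM _ hl
  rw [map_sub, hτa, zero_sub, neg_eq_zero, map_smul, smul_eq_mul] at h1
  refine (mul_eq_zero.1 h1).resolve_right fun hτe ↦ ?_
  have hright : ∀ x, τ (x * e) = τ x := fun x ↦ by
    have := hτM _ (he x).1
    rw [map_sub, sub_eq_zero] at this
    exact this.symm
  have hleft : ∀ x, τ (star e * x) = τ x := fun x ↦ by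
    have := hτM _ (hM.star_mem (he (star x)).1)
    rw [star_sub, star_mul, star_star, map_sub, sub_eq_zero] at this
    exact this.symm
  have hτe' : τ (star e) = 0 := by rw [← hright, hleft, hτe]
  have hlin : ∀ r s : ℝ, (∀ t : ℝ, 0 ≤ r + t * s) → s = 0 := fun r s H ↦ by
    by_contra hs
    have := H (-(r + 1) / s)
    rw [div_mul_cancel₀ _ hs] at this
    linarith
  have hτ0 : ∀ x, τ x = 0 := fun x ↦ by
    have key : ∀ t : ℂ, 0 ≤ τ (x * star x) + (t * τ x + (starRingEnd ℂ) t * τ (star x)) := by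
      intro t
      have h2 := hpos (star x + t • e)
      have h3 : τ (star (star x + t • e) * (star x + t • e)) =
          τ (x * star x) + (t * τ x + (starRingEnd ℂ) t * τ (star x)) := by
        simp only [star_add, star_star, star_smul, add_mul, mul_add, smul_mul_assoc,
          mul_smul_comm, map_add, map_smul, smul_eq_mul, hright, hleft, hτe', mul_zero, add_zero,
          Complex.star_def]
        ring
      rwa [h3] at h2
    have h4 := fun t ↦ (Complex.nonneg_iff.1 (key t)).1
    have h5 := fun t ↦ (Complex.nonneg_iff.1 (key t)).2
    have i0 := h5 0
    have i1 := h5 1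
    have i2 := h5 Complex.I
    have r1 := hlin _ _ fun t ↦ by
      have := h4 t
      simp only [Complex.add_re, Complex.conj_ofReal, Complex.re_ofReal_mul, ← mul_add] at this
      exact this
    have r2 := hlin _ (-(τ x).im + (τ (star x)).im) fun t ↦ by
      have := h4 (t * Complex.I)
      simp only [Complex.add_re, map_mul, Complex.conj_ofReal, Complex.conj_I, mul_assoc,
        Complex.re_ofReal_mul, neg_mul, Complex.neg_re, Complex.I_mul_re, neg_neg, ← mul_add]
        at this
      exact this
    simp at i0 i1 i2
    apply Complex.ext
    · rw [Complex.zero_re]; linarith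
    · rw [Complex.zero_im]; linarith
  have : τ = 0 := ContinuousLinearMap.ext hτ0
  rw [this, norm_zero] at hτn
  exact zero_ne_one hτn

end TraceVanishing

section Main

open WeakDual

variable {A : Type*} [NonUnitalCStarAlgebra A]

/-- Characters of the centre of a quotient that agree on the image of the centre of `A` agree on
every central limit of sums of commutators. -/
theorem character_eq_of_trace
    (h : ∀ M ∈ Tset (Set.univ : Set A), QuotientHasTracialState M) {a : A}
    (ha : a ∈ closure (commutatorSpan A)) {Q : Type*} [CStarAlgebra Q] (q : A →⋆ₙₐ[ℂ] Q)
    {c : starCenter Q} (hc : q a = c) {d : A → starCenter Q}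
    (hd : ∀ z ∈ centerOf (Set.univ : Set A), q z = d z) {χ₁ χ₂ : characterSpace ℂ (starCenter Q)}
    (hχ : ∀ z ∈ centerOf (Set.univ : Set A), χ₁ (d z) = χ₂ (d z)) : χ₁ c = χ₂ c := by
  have hmemM : ∀ {M : Set A} {e b : A} {l : ℂ}, IsIdealOf M Set.univ → e ∉ M → b - l • e ∈ M →
      (b ∈ M ↔ l = 0) := fun {M e b l} hM he hb ↦ by
    refine ⟨fun hbM ↦ ?_, fun hl ↦ by rwa [hl, zero_smul, sub_zero] at hb⟩
    by_contra hl
    have h1 := hM.smul_mem l⁻¹ (hM.sub_mem hbM hb)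
    rw [sub_sub_cancel, smul_smul, inv_mul_cancel₀ hl, one_smul] at h1
    exact he h1
  by_cases hz : ∃ z ∈ centerOf (Set.univ : Set A), χ₁ (d z) ≠ 0
  · obtain ⟨z, hz, hz1⟩ := hz
    have hqe : q ((χ₁ (d z))⁻¹ • z) = ((χ₁ (d z))⁻¹ • d z : starCenter Q) := by
      rw [map_smul, hd z hz]
      rfl
    obtain ⟨M, hM, heM, heM', hMb⟩ := exists_isModMaxIdealOf_of_character q χ₁ hqe
      (by rw [map_smul, smul_eq_mul, inv_mul_cancel₀ hz1])
    obtain ⟨N, hN, heN, heN', hNb⟩ := exists_isModMaxIdealOf_of_character q χ₂ hqe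
      (by rw [map_smul, smul_eq_mul, ← hχ z hz, inv_mul_cancel₀ hz1])
    by_cases hMN : M = N
    · subst hMN
      have h1 := hM.1.sub_mem (hMb a c hc) (hNb a c hc)
      rw [sub_sub_sub_cancel_left, ← sub_smul] at h1
      have h2 := (hmemM hM.1 heM' (b := (χ₂ c - χ₁ c) • _) (l := χ₂ c - χ₁ c)
        (by rw [sub_self]; exact hM.1.2.2.1)).1 h1
      exact (sub_eq_zero.1 h2).symm
    · have hMz : ¬ centerOf Set.univ ⊆ M := fun hsub ↦
        hz1 ((hmemM hM.1 heM' (hMb z _ (hd z hz))).1 (hsub hz))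
      have hNz : ¬ centerOf Set.univ ⊆ N := fun hsub ↦
        hz1 ((hχ z hz).trans ((hmemM hN.1 heN' (hNb z _ (hd z hz))).1 (hsub hz)))
      have hMNz : M ∩ centerOf Set.univ = N ∩ centerOf Set.univ := by
        ext y
        refine and_congr_left fun hy ↦ ?_
        rw [hmemM hM.1 heM' (hMb y _ (hd y hy)), hmemM hN.1 heN' (hNb y _ (hd y hy)), hχ y hy]
      rw [eq_zero_of_sub_smul_mem hM.1
          (h M ⟨hM, .inr ⟨N, hN, fun h ↦ hMN h.symm, hMz, hNz, hMNz⟩⟩) heM ha (hMb a c hc),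
        eq_zero_of_sub_smul_mem hN.1 (h N ⟨hN, .inr ⟨M, hM, hMN, hNz, hMz, hMNz.symm⟩⟩) heN ha
          (hNb a c hc)]
  · push Not at hz
    have hzero : ∀ χ : characterSpace ℂ (starCenter Q),
        (∀ z ∈ centerOf (Set.univ : Set A), χ (d z) = 0) → χ c = 0 := fun χ hχ0 ↦ by
      by_contra hc0
      have hqe : q ((χ c)⁻¹ • a) = ((χ c)⁻¹ • c : starCenter Q) := by
        rw [map_smul, hc]
        rfl
      obtain ⟨M, hM, heM, heM', hMb⟩ := exists_isModMaxIdealOf_of_character q χ hqe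
        (by rw [map_smul, smul_eq_mul, inv_mul_cancel₀ hc0])
      have hMz : centerOf Set.univ ⊆ M := fun z hz ↦
        (hmemM hM.1 heM' (hMb z _ (hd z hz))).2 (hχ0 z hz)
      exact hc0 (eq_zero_of_sub_smul_mem hM.1 (h M ⟨hM, .inl hMz⟩) heM ha (hMb a c hc))
    rw [hzero χ₁ hz, hzero χ₂ fun z hz' ↦ (hχ z hz').symm.trans (hz z hz')]

theorem closure_commutatorSpan_subset_CQset
    (h : ∀ M ∈ Tset (Set.univ : Set A), QuotientHasTracialState M) :
    closure (commutatorSpan A) ⊆ CQset (Set.univ : Set A) := by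
  refine fun a ha ↦ ⟨trivial, fun I hI hcomm ↦ ?_⟩
  have := isTwoSided_unitizationIdeal hI
  obtain ⟨Q, _, π, hsurj, hker⟩ :=
    exists_cstar_quotient (unitizationIdeal hI) (isClosed_unitizationIdeal hI)
  have hac : π (a : Unitization ℂ A) ∈ starCenter Q := by
    refine mem_starCenter.2 fun y ↦ ?_
    obtain ⟨x, rfl⟩ := hsurj y
    rw [← map_mul, ← map_mul, ← sub_eq_zero, ← map_sub, hker, mem_unitizationIdeal]
    refine ⟨x.snd * a - a * x.snd, ?_, ?_⟩
    · rw [← neg_sub]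
      exact hI.2.2.2.2.1 _ (hcomm _ trivial)
    · rw [eq_sub_iff_add_eq]
      ext
      · simp [-Unitization.inr_sub, mul_comm]
      · simp [-Unitization.inr_sub]
        abel
  set φ : starCenter (Unitization ℂ A) →⋆ₐ[ℂ] starCenter Q :=
    (π.comp (starCenter (Unitization ℂ A)).subtype).codRestrict (starCenter Q) fun z ↦
      mem_starCenter.2 fun y ↦ by
        obtain ⟨x, rfl⟩ := hsurj y
        change π x * π z = π z * π x
        rw [← map_mul, ← map_mul, mem_starCenter.1 z.2] with hφ
  have hφ_coe : ∀ z, (φ z : Q) = π z := fun z ↦ rfl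
  have hcenter : ∀ z ∈ centerOf (Set.univ : Set A),
      (z : Unitization ℂ A) ∈ starCenter (Unitization ℂ A) := fun z hz ↦
    mem_starCenter.2 fun x ↦ by ext <;> simp [mul_comm, hz.2 x.snd trivial]
  classical
  obtain ⟨z, hz⟩ := exists_map_eq_of_characters φ ⟨_, hac⟩ fun χ₁ χ₂ hχ ↦
    character_eq_of_trace h ha
      ((π : Unitization ℂ A →⋆ₙₐ[ℂ] Q).comp (Unitization.inrNonUnitalStarAlgHom ℂ A)) rfl
      (d := fun z ↦ if hz : z ∈ centerOf Set.univ then φ ⟨z, hcenter z hz⟩ else 0)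
      (fun z hz ↦ by rw [dif_pos hz]; rfl) (fun z hz ↦ by rw [dif_pos hz]; exact hχ _)
  have hza : (z : Unitization ℂ A) - a ∈ unitizationIdeal hI := by
    rw [← hker, map_sub, sub_eq_zero, ← hφ_coe, hz]
  obtain ⟨y, hy, hyz⟩ := hza
  rw [eq_sub_iff_add_eq, ← Unitization.inr_add] at hyz
  refine ⟨y + a, ⟨trivial, fun x _ ↦ ?_⟩, ?_⟩
  · have := mem_starCenter.1 z.2 x
    rw [← hyz, ← Unitization.inr_mul, ← Unitization.inr_mul] at this
    exact (Unitization.inr_injective this).symm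
  · rw [sub_add_cancel_right]
    exact hI.2.2.2.2.1 _ hy

end Main

end CQP

/-- **Theorem 4.10.** Let `A` be a C*-algebra that is not weakly central.
(a) If `A/M` admits a tracial state for every `M ∈ T_A`, then the norm-closure of
`[A,A]` is contained in `CQ(A)`.
(b) If there is `M ∈ T_A` such that `A/M` admits no tracial state, then `[A,A]` is not
contained in `CQ(A)`. -/
theorem stmt17 {A : Type*} [NonUnitalCStarAlgebra A]
    (hA : ¬ WeaklyCentral (Set.univ : Set A)) :
    ((∀ M ∈ Tset (Set.univ : Set A), QuotientHasTracialState M) →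
      closure (commutatorSpan A) ⊆ CQset (Set.univ : Set A)) ∧
    ((∃ M ∈ Tset (Set.univ : Set A), ¬ QuotientHasTracialState M) →
      ¬ commutatorSpan A ⊆ CQset (Set.univ : Set A)) := by
  exact ⟨closure_commutatorSpan_subset_CQset, fun ⟨_, hM, htr⟩ ↦
    not_commutatorSpan_subset_CQset hM htr⟩
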